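/- arXiv:2506.10736 — 8 statements merged into one kernel-verified Lean document; each statement's English description precedes it below -/
import Mathlib

section
/- For all n : ℕ and all a, b, c, d : Fin n → ZMod 2, the Pauli operators satisfy the multiplication law (X^aZ^b) * (X^cZ^d) = (-1)^{f(b,c)} • X^{a+c}Z^{b+d}, where the sum a+c and b+d are taken pointwise in ZMod 2. -/
open Matrix

noncomputable def σx : Matrix (Fin 2) (Fin 2) ℂ := !![0, 1; 1, 0]
noncomputable def σz : Matrix (Fin 2) (Fin 2) ℂ := !![1, 0; 0, -1]

/-- The Pauli operator `X^a Z^b` on `n` qubits, realized as the matrix whose `(f, g)` entry is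
`∏ i, ((σx ^ (a i).val) * (σz ^ (b i).val)) (f i) (g i)`. -/
noncomputable def pauliXZ (n : ℕ) (a b : Fin n → ZMod 2) :
    Matrix (Fin n → Fin 2) (Fin n → Fin 2) ℂ :=
  fun f g => ∏ i, ((σx ^ (a i).val) * (σz ^ (b i).val)) (f i) (g i)

/-- `f(a,b)`: the number of indices where both `a` and `b` are `1`. -/
def pauliSign (n : ℕ) (a b : Fin n → ZMod 2) : ℕ :=
  (Finset.univ.filter (fun i => a i = 1 ∧ b i = 1)).card

theorem pauliSingle_mul (a b c d : ZMod 2) :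
    (σx ^ a.val * σz ^ b.val) * (σx ^ c.val * σz ^ d.val)
      = (if b = 1 ∧ c = 1 then (-1 : ℂ) else 1) • (σx ^ (a + c).val * σz ^ (b + d).val) := by
  have hxx : σx * σx = 1 := by simp [σx, Matrix.one_fin_two]
  have hzz : σz * σz = 1 := by simp [σz, Matrix.one_fin_two]
  have hzx : σz * σx = -(σx * σz) := by simp [σx, σz]
  have hx (a c : ZMod 2) : σx ^ a.val * σx ^ c.val = σx ^ (a + c).val := by
    rw [← pow_add, ZMod.val_add, pow_eq_pow_mod (a.val + c.val) (by rw [pow_two, hxx])]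
  have hz (b d : ZMod 2) : σz ^ b.val * σz ^ d.val = σz ^ (b + d).val := by
    rw [← pow_add, ZMod.val_add, pow_eq_pow_mod (b.val + d.val) (by rw [pow_two, hzz])]
  have hcomm : σz ^ b.val * σx ^ c.val
      = (if b = 1 ∧ c = 1 then (-1 : ℂ) else 1) • (σx ^ c.val * σz ^ b.val) := by
    have h01 : ∀ x : ZMod 2, x = 0 ∨ x = 1 := by decide
    rcases h01 b with rfl | rfl <;> rcases h01 c with rfl | rfl <;> simp [ZMod.val_one, hzx]
  rw [← hx, ← hz, Matrix.mul_assoc, ← Matrix.mul_assoc (σz ^ b.val), hcomm]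
  simp only [Matrix.smul_mul, Matrix.mul_smul, Matrix.mul_assoc]

theorem pauli_mul (n : ℕ) (a b c d : Fin n → ZMod 2) :
    pauliXZ n a b * pauliXZ n c d
      = ((-1 : ℂ) ^ pauliSign n b c) • pauliXZ n (a + c) (b + d) := by
  ext f g
  have hsign : (-1 : ℂ) ^ pauliSign n b c = ∏ i, if b i = 1 ∧ c i = 1 then (-1 : ℂ) else 1 := by
    rw [pauliSign, ← Finset.prod_const, Finset.prod_filter]
  calc (pauliXZ n a b * pauliXZ n c d) f g
      = ∑ k : Fin n → Fin 2, ∏ i, (σx ^ (a i).val * σz ^ (b i).val) (f i) (k i)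
          * (σx ^ (c i).val * σz ^ (d i).val) (k i) (g i) := by
        simp only [Matrix.mul_apply (M := pauliXZ n a b), pauliXZ, Finset.prod_mul_distrib]
    _ = ∏ i, ((σx ^ (a i).val * σz ^ (b i).val) * (σx ^ (c i).val * σz ^ (d i).val))
          (f i) (g i) := by
        simp only [Matrix.mul_apply (M := σx ^ _ * σz ^ _)]
        rw [Fintype.prod_sum]
    _ = (((-1 : ℂ) ^ pauliSign n b c) • pauliXZ n (a + c) (b + d)) f g := by
        simp only [pauliSingle_mul, Matrix.smul_apply, smul_eq_mul, pauliXZ, hsign,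
          Finset.prod_mul_distrib, Pi.add_apply]
end

section
/- For all n : ℕ and all a, b : Fin n → ZMod 2, the conjugate transpose of a Pauli operator satisfies (X^aZ^b)ᴴ = (-1)^{f(a,b)} • X^aZ^b; in particular each X^aZ^b is self-adjoint up to the sign (-1)^{f(a,b)}. -/
open Matrix

/-- The single-qubit case: `σx ^ a * σz ^ b` is self-adjoint up to a sign, which is `-1` exactly
when both exponents are `1`. -/
theorem conjTranspose_σx_pow_mul_σz_pow (a b : ZMod 2) :
    (σx ^ a.val * σz ^ b.val)ᴴ =
      (if a = 1 ∧ b = 1 then (-1 : ℂ) else 1) • (σx ^ a.val * σz ^ b.val) := by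
  have eq_zero_or_one : ∀ c : ZMod 2, c = 0 ∨ c = 1 := by decide
  ext i j
  obtain rfl | rfl := eq_zero_or_one a <;> obtain rfl | rfl := eq_zero_or_one b <;>
    fin_cases i <;> fin_cases j <;> simp [σx, σz, ZMod.val_one]

theorem neg_one_pow_pauliSign (n : ℕ) (a b : Fin n → ZMod 2) :
    (-1 : ℂ) ^ pauliSign n a b = ∏ i, if a i = 1 ∧ b i = 1 then (-1 : ℂ) else 1 := by
  rw [pauliSign, Finset.prod_ite, Finset.prod_const, Finset.prod_const_one, mul_one]

theorem pauli_conjTranspose (n : ℕ) (a b : Fin n → ZMod 2) :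
    (pauliXZ n a b)ᴴ = ((-1 : ℂ) ^ pauliSign n a b) • pauliXZ n a b := by
  ext f g
  rw [Matrix.smul_apply, smul_eq_mul, neg_one_pow_pauliSign, conjTranspose_apply, pauliXZ, pauliXZ,
    star_prod, ← Finset.prod_mul_distrib]
  refine Finset.prod_congr rfl fun i _ => ?_
  simpa only [conjTranspose_apply, Matrix.smul_apply, smul_eq_mul] using
    congrFun₂ (conjTranspose_σx_pow_mul_σz_pow (a i) (b i)) (f i) (g i)
end

section
/- For every n : ℕ, the Jordan–Wigner family satisfies the CAR relations: for k : Fin n define c k ∈ Matrix (Fin n → Fin 2) (Fin n → Fin 2) ℂ as the n-fold Kronecker product whose j-th factor is σz for j < k, is A₀ = !![0,1;0,0] for j = k, and is the identity for j > k (concretely, (c k) f g = (∏_{j < k} σz (f j) (g j)) * A₀ (f k) (g k) * ∏_{j > k} (if f j = g j then 1 else 0)). Then for all j k : Fin n: (c j) * (c k) + (c k) * (c j) = 0 and (c j) * (c k)ᴴ + (c k)ᴴ * (c j) = (if j = k then 1 else 0). -/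
open Matrix

noncomputable def A₀ : Matrix (Fin 2) (Fin 2) ℂ := !![0, 1; 0, 0]

/-- The Jordan–Wigner generator `c k = σz ⊗ ⋯ ⊗ σz ⊗ A₀ ⊗ 1 ⊗ ⋯ ⊗ 1` on `n` qubits. -/
noncomputable def jordanWigner (n : ℕ) (k : Fin n) :
    Matrix (Fin n → Fin 2) (Fin n → Fin 2) ℂ :=
  fun f g =>
    (∏ j ∈ Finset.univ.filter (fun j => j < k), σz (f j) (g j)) *
      A₀ (f k) (g k) *
      ∏ j ∈ Finset.univ.filter (fun j => k < j), (if f j = g j then (1 : ℂ) else 0)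

section PiKronecker

variable {ι m R : Type*} [Fintype ι]

/-- The Kronecker product of a finite family of matrices, indexed by functions. -/
def piKronecker [CommSemiring R] (M : ι → Matrix m m R) : Matrix (ι → m) (ι → m) R :=
  fun f g => ∏ i, M i (f i) (g i)

theorem piKronecker_mul [CommSemiring R] [Fintype m] [DecidableEq ι]
    (M N : ι → Matrix m m R) :
    piKronecker M * piKronecker N = piKronecker (fun i => M i * N i) := by
  ext f g
  simp only [piKronecker, Matrix.mul_apply, Finset.prod_univ_sum, Fintype.piFinset_univ,
    Finset.prod_mul_distrib]

theorem conjTranspose_piKronecker [CommSemiring R] [StarRing R] (M : ι → Matrix m m R) :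
    (piKronecker M)ᴴ = piKronecker (fun i => (M i)ᴴ) := by
  ext f g
  simp [piKronecker, Matrix.conjTranspose_apply]

theorem piKronecker_one [CommSemiring R] [DecidableEq ι] [DecidableEq m] :
    piKronecker (fun _ : ι => (1 : Matrix m m R)) = 1 := by
  ext f g
  simp only [piKronecker, Matrix.one_apply, Finset.prod_ite_zero, Finset.prod_const_one,
    Finset.mem_univ, true_imp_iff, funext_iff]

theorem piKronecker_eq_zero [CommSemiring R] {M : ι → Matrix m m R} (k : ι) (hk : M k = 0) :
    piKronecker M = 0 := by
  ext f g
  exact Finset.prod_eq_zero (Finset.mem_univ k) (by simp [hk])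

/-- The Kronecker product is additive in each factor. -/
theorem piKronecker_add [CommSemiring R] [DecidableEq ι] {M N L : ι → Matrix m m R} (k : ι)
    (hM : ∀ i, i ≠ k → M i = L i) (hN : ∀ i, i ≠ k → N i = L i) (hk : M k + N k = L k) :
    piKronecker M + piKronecker N = piKronecker L := by
  ext f g
  simp only [piKronecker, Matrix.add_apply, ← Finset.mul_prod_erase _ _ (Finset.mem_univ k)]
  rw [← hk, Matrix.add_apply, add_mul]
  congr 2 <;> refine Finset.prod_congr rfl fun i hi => ?_
  · rw [hM i (Finset.ne_of_mem_erase hi)]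
  · rw [hN i (Finset.ne_of_mem_erase hi)]

/-- Kronecker products anticommute if their factors do so at one site and commute elsewhere. -/
theorem piKronecker_anticommute [CommSemiring R] [Fintype m] [DecidableEq ι]
    {M N : ι → Matrix m m R} (k : ι) (hk : M k * N k + N k * M k = 0)
    (h : ∀ i, i ≠ k → Commute (M i) (N i)) :
    piKronecker M * piKronecker N + piKronecker N * piKronecker M = 0 := by
  rw [piKronecker_mul, piKronecker_mul,
    piKronecker_add (L := Function.update (fun i => M i * N i) k 0) k]
  · exact piKronecker_eq_zero k (by simp)
  · intro i hi
    simp [hi]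
  · intro i hi
    simpa [hi] using (h i hi).eq.symm
  · simpa using hk

end PiKronecker

/-- The factor at site `i` of the Jordan–Wigner generator at site `k`. -/
noncomputable def jordanWignerFactor {n : ℕ} (k i : Fin n) : Matrix (Fin 2) (Fin 2) ℂ :=
  if i < k then σz else if i = k then A₀ else 1

theorem jordanWigner_eq_piKronecker (n : ℕ) (k : Fin n) :
    jordanWigner n k = piKronecker (jordanWignerFactor k) := by
  ext f g
  simp only [jordanWigner, piKronecker, Finset.prod_filter]
  rw [← Fintype.prod_ite_eq' k (fun i => A₀ (f i) (g i)), ← Finset.prod_mul_distrib,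
    ← Finset.prod_mul_distrib]
  refine Finset.prod_congr rfl fun i _ => ?_
  rcases lt_trichotomy i k with h | rfl | h
  · simp [jordanWignerFactor, h, h.ne, h.not_gt]
  · simp [jordanWignerFactor]
  · simp [jordanWignerFactor, h, h.ne', h.not_gt, Matrix.one_apply]

theorem σz_conjTranspose : σzᴴ = σz := by
  ext i j
  fin_cases i <;> fin_cases j <;> simp [σz]

theorem σz_mul_self : σz * σz = 1 := by
  simp [σz, Matrix.one_fin_two]

theorem A₀_mul_self : A₀ * A₀ = 0 := by
  ext i j
  fin_cases i <;> fin_cases j <;> simp [A₀]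

theorem A₀_mul_conjTranspose_add : A₀ * A₀ᴴ + A₀ᴴ * A₀ = 1 := by
  ext i j
  fin_cases i <;> fin_cases j <;> simp [A₀, Matrix.vecMul, dotProduct, Matrix.mul_apply]

theorem A₀_mul_σz_add : A₀ * σz + σz * A₀ = 0 := by
  ext i j
  fin_cases i <;> fin_cases j <;> simp [A₀, σz]

theorem jordanWigner_anticommute_of_lt {n : ℕ} {j k : Fin n} (h : j < k) :
    jordanWigner n j * jordanWigner n k + jordanWigner n k * jordanWigner n j = 0 := by
  simp only [jordanWigner_eq_piKronecker]
  refine piKronecker_anticommute j ?_ fun i hi => ?_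
  · simpa [jordanWignerFactor, h] using A₀_mul_σz_add
  · rcases hi.lt_or_gt with hij | hij
    · simp [jordanWignerFactor, hij, hij.trans h]
    · simp [jordanWignerFactor, hij.not_gt, hij.ne']

theorem jordanWigner_anticommute_conjTranspose_of_lt {n : ℕ} {j k : Fin n} (h : j < k) :
    jordanWigner n j * (jordanWigner n k)ᴴ + (jordanWigner n k)ᴴ * jordanWigner n j = 0 := by
  simp only [jordanWigner_eq_piKronecker, conjTranspose_piKronecker]
  refine piKronecker_anticommute j ?_ fun i hi => ?_
  · simpa [jordanWignerFactor, h, σz_conjTranspose] using A₀_mul_σz_add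
  · rcases hi.lt_or_gt with hij | hij
    · simp [jordanWignerFactor, hij, hij.trans h, σz_conjTranspose]
    · simp [jordanWignerFactor, hij.not_gt, hij.ne']

theorem jordanWigner_mul_self (n : ℕ) (k : Fin n) : jordanWigner n k * jordanWigner n k = 0 := by
  rw [jordanWigner_eq_piKronecker, piKronecker_mul]
  exact piKronecker_eq_zero k (by simp [jordanWignerFactor, A₀_mul_self])

theorem jordanWigner_mul_conjTranspose_add (n : ℕ) (k : Fin n) :
    jordanWigner n k * (jordanWigner n k)ᴴ + (jordanWigner n k)ᴴ * jordanWigner n k = 1 := by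
  simp only [jordanWigner_eq_piKronecker, conjTranspose_piKronecker, piKronecker_mul]
  rw [← piKronecker_one]
  refine piKronecker_add k (fun i hi => ?_) (fun i hi => ?_) ?_
  · by_cases h : i < k <;> simp [jordanWignerFactor, h, hi, σz_conjTranspose, σz_mul_self]
  · by_cases h : i < k <;> simp [jordanWignerFactor, h, hi, σz_conjTranspose, σz_mul_self]
  · simpa [jordanWignerFactor] using A₀_mul_conjTranspose_add

theorem jordanWigner_car (n : ℕ) (j k : Fin n) :
    jordanWigner n j * jordanWigner n k + jordanWigner n k * jordanWigner n j = 0 ∧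
    jordanWigner n j * (jordanWigner n k)ᴴ + (jordanWigner n k)ᴴ * jordanWigner n j
      = (if j = k then 1 else 0) := by
  rcases lt_trichotomy j k with h | rfl | h
  · rw [if_neg h.ne]
    exact ⟨jordanWigner_anticommute_of_lt h, jordanWigner_anticommute_conjTranspose_of_lt h⟩
  · simp [jordanWigner_mul_self, jordanWigner_mul_conjTranspose_add]
  · rw [if_neg h.ne', add_comm]
    refine ⟨jordanWigner_anticommute_of_lt h, ?_⟩
    simpa [add_comm] using
      congrArg conjTranspose (jordanWigner_anticommute_conjTranspose_of_lt h)
end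

section
/- Let A be a unital ℂ-algebra with a star-ring structure that is a star module over ℂ, and let a : Fin n → A satisfy the CAR relations. Define the parity operator Γ := ∏_{i ∈ Finset.univ} (1 - 2 • (star (a i) * a i)) (the factors pairwise commute, so the product is well defined). Then star Γ = Γ, Γ * Γ = 1, and Γ anticommutes with each generator: Γ * a j + a j * Γ = 0 for all j : Fin n. -/
/-- A product of pairwise commuting self-adjoint elements is self-adjoint. -/
theorem List.isSelfAdjoint_prod_of_commute {M : Type*} [Monoid M] [StarMul M] {l : List M}
    (hsa : ∀ x ∈ l, IsSelfAdjoint x) (hcomm : ∀ x ∈ l, ∀ y ∈ l, Commute x y) :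
    IsSelfAdjoint l.prod := by
  induction l with
  | nil => simp
  | cons x l ih =>
    simp only [List.mem_cons, forall_eq_or_imp] at hsa hcomm
    have hl : IsSelfAdjoint l.prod := ih hsa.2 fun y hy => (hcomm.2 y hy).2
    rw [List.prod_cons]
    exact (hsa.1.commute_iff hl).1 (Commute.list_prod_right l x hcomm.1.2)

/-- A product of pairwise commuting involutions is an involution. -/
theorem List.prod_mul_self_of_commute {M : Type*} [Monoid M] {l : List M}
    (hinv : ∀ x ∈ l, x * x = 1) (hcomm : ∀ x ∈ l, ∀ y ∈ l, Commute x y) :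
    l.prod * l.prod = 1 := by
  induction l with
  | nil => simp
  | cons x l ih =>
    simp only [List.mem_cons, forall_eq_or_imp] at hinv hcomm
    have hx : Commute x l.prod := Commute.list_prod_right l x hcomm.1.2
    rw [List.prod_cons, hx.symm.mul_mul_mul_comm, hinv.1,
      ih hinv.2 fun y hy => (hcomm.2 y hy).2, one_mul]

/-- If `y` anticommutes with `f j` and commutes with all other `f i`, then it anticommutes with
any product of the `f i` without repetition in which `f j` occurs. -/
theorem List.prod_map_mul_eq_neg_of_mem {R ι : Type*} [Ring R] {f : ι → R} {y : R} {j : ι}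
    (hj : f j * y = -(y * f j)) (hne : ∀ i, i ≠ j → Commute (f i) y)
    {l : List ι} (hl : l.Nodup) (hmem : j ∈ l) :
    (l.map f).prod * y = -(y * (l.map f).prod) := by
  induction l with
  | nil => simp at hmem
  | cons i l ih =>
    rw [List.nodup_cons] at hl
    rw [List.map_cons, List.prod_cons]
    by_cases hij : i = j
    · subst hij
      have hc : Commute (l.map f).prod y := by
        refine Commute.list_prod_left _ _ fun x hx => ?_
        obtain ⟨k, hk, rfl⟩ := List.mem_map.1 hx
        exact hne k fun h => hl.1 (h ▸ hk)
      rw [mul_assoc, hc.eq, ← mul_assoc, hj, neg_mul, mul_assoc]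
    · have hjl : j ∈ l := (List.mem_cons.1 hmem).resolve_left (Ne.symm hij)
      rw [mul_assoc, ih hl.2 hjl, mul_neg, ← mul_assoc, (hne i hij).eq, mul_assoc]

/-- A product of two elements anticommuting with `z` commutes with `z`. -/
theorem Commute.mul_left_of_anticommute {R : Type*} [Ring R] {x y z : R}
    (hx : x * z + z * x = 0) (hy : y * z + z * y = 0) : Commute (x * y) z := by
  rw [commute_iff_eq, mul_assoc, eq_neg_of_add_eq_zero_left hy, mul_neg, ← mul_assoc,
    eq_neg_of_add_eq_zero_left hx, neg_mul, neg_neg, mul_assoc]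

theorem car_parity_operator {A : Type*} [Ring A] [Algebra ℂ A] [StarRing A] [StarModule ℂ A]
    {n : ℕ} (a : Fin n → A)
    (hCAR : ∀ i j : Fin n,
      a i * a j + a j * a i = 0 ∧
      a i * star (a j) + star (a j) * a i = (if i = j then 1 else 0))
    (Γ : A)
    (hΓ : Γ = (List.ofFn (fun i : Fin n => 1 - 2 • (star (a i) * a i))).prod) :
    star Γ = Γ ∧ Γ * Γ = 1 ∧ ∀ j : Fin n, Γ * a j + a j * Γ = 0 := by
  have hsq (i : Fin n) : a i * a i = 0 := by
    have h := (hCAR i i).1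
    rw [← two_smul ℂ] at h
    exact (smul_eq_zero_iff_right two_ne_zero).1 h
  have haba (i : Fin n) : a i * (star (a i) * a i) = a i := by
    have h := (hCAR i i).2
    rw [if_pos rfl] at h
    rw [← mul_assoc, eq_sub_of_add_eq h, sub_mul, mul_assoc, hsq, mul_zero, sub_zero, one_mul]
  set f : Fin n → A := fun i => 1 - 2 • (star (a i) * a i) with hf
  have hsa (i : Fin n) : IsSelfAdjoint (f i) :=
    (IsSelfAdjoint.one A).sub (.smul (.all (2 : ℕ)) (.star_mul_self (a i)))
  have hinv (i : Fin n) : f i * f i = 1 := by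
    have h : star (a i) * a i * (star (a i) * a i) = star (a i) * a i := by
      rw [mul_assoc, haba]
    simp only [hf, sub_mul, mul_sub, one_mul, mul_one, smul_mul_smul_comm, h]
    module
  have hanti (j : Fin n) : f j * a j = -(a j * f j) := by
    simp only [hf, sub_mul, mul_sub, one_mul, mul_one, smul_mul_assoc, mul_smul_comm, haba,
      mul_assoc, hsq, mul_zero]
    module
  have hne (i j : Fin n) (hij : i ≠ j) : Commute (f i) (a j) := by
    refine (Commute.one_left _).sub_left (Commute.smul_left ?_ 2)
    refine Commute.mul_left_of_anticommute ?_ (hCAR i j).1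
    rw [add_comm, (hCAR j i).2, if_neg hij.symm]
  have hcomm (i j : Fin n) : Commute (f i) (f j) := by
    by_cases hij : i = j
    · rw [hij]
    · have h := (hne i j hij).star_star
      rw [(hsa i).star_eq] at h
      exact (Commute.one_right _).sub_right ((h.mul_right (hne i j hij)).smul_right 2)
  subst hΓ
  refine ⟨?_, ?_, fun j => ?_⟩
  · exact List.isSelfAdjoint_prod_of_commute (by simpa [List.mem_ofFn] using hsa)
      (by simpa [List.mem_ofFn] using hcomm)
  · exact List.prod_mul_self_of_commute (by simpa [List.mem_ofFn] using hinv)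
      (by simpa [List.mem_ofFn] using hcomm)
  · rw [List.ofFn_eq_map, List.prod_map_mul_eq_neg_of_mem (hanti j) (fun i hi => hne i j hi)
      (List.nodup_finRange n) (List.mem_finRange j), neg_add_cancel]
end

section
/- Let a : Fin n → Matrix (Fin N) (Fin N) ℂ satisfy the CAR relations (with star given by conjugate transpose), and let Γ := ∏_{i ∈ Finset.univ} (1 - 2 • ((a i)ᴴ * a i)). Define b : Fin (n+1) → Matrix (Fin N × Fin 2) (Fin N × Fin 2) ℂ by b (Fin.castSucc i) = (a i) ⊗ₖ (1 : Matrix (Fin 2) (Fin 2) ℂ) for i : Fin n, and b (Fin.last n) = Γ ⊗ₖ !![0,1;0,0]. Then b satisfies the CAR relations. -/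
open Matrix Kronecker

section NumberOperators

variable {R : Type*} [Ring R] [StarRing R]

/-- For a fermionic mode `x`, the parity `1 - 2 x⋆x` is unitary. -/
theorem one_sub_two_star_mul_self_mem_unitary {x : R} (hx : x * x = 0)
    (hx' : x * star x + star x * x = 1) : 1 - 2 • (star x * x) ∈ unitary R := by
  have hsa : star (1 - 2 • (star x * x)) = 1 - 2 • (star x * x) := by
    simp only [two_nsmul, star_sub, star_one, star_add, star_mul, star_star]
  have hidem : star x * x * (star x * x) = star x * x := by
    calc star x * x * (star x * x) = star x * (x * star x + star x * x) * x
          - star x * star x * (x * x) := by noncomm_ring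
      _ = star x * x := by simp [hx, hx']
  have hsq : (1 - 2 • (star x * x)) * (1 - 2 • (star x * x)) = 1 := by
    calc (1 - 2 • (star x * x)) * (1 - 2 • (star x * x))
        = 1 - 4 • (star x * x) + 4 • (star x * x * (star x * x)) := by noncomm_ring
      _ = 1 := by rw [hidem]; abel
  rw [Unitary.mem_iff, hsa]
  exact ⟨hsq, hsq⟩

theorem one_sub_two_star_mul_self_anticomm {x : R} (hx : x * x = 0)
    (hx' : x * star x + star x * x = 1) :
    (1 - 2 • (star x * x)) * x = -(x * (1 - 2 • (star x * x))) := by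
  have h : x * star x * x = x := by
    calc x * star x * x = (x * star x + star x * x) * x - star x * (x * x) := by noncomm_ring
      _ = x := by simp [hx, hx']
  calc (1 - 2 • (star x * x)) * x
      = -(x * (1 - 2 • (star x * x))) + 2 • (x - x * star x * x) - 2 • (star x * (x * x)) := by
        noncomm_ring
    _ = -(x * (1 - 2 • (star x * x))) := by simp [hx, h]

theorem one_sub_two_star_mul_self_comm {x y : R} (h : x * y + y * x = 0)
    (h' : x * star y + star y * x = 0) :
    (1 - 2 • (star y * y)) * x = x * (1 - 2 • (star y * y)) := by
  calc (1 - 2 • (star y * y)) * x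
      = x * (1 - 2 • (star y * y)) + 2 • ((x * star y + star y * x) * y)
          - 2 • (star y * (x * y + y * x)) := by noncomm_ring
    _ = x * (1 - 2 • (star y * y)) := by simp [h, h']

end NumberOperators

theorem List.prod_map_mul_eq_neg_mul_prod_map {R ι : Type*} [Ring R] {g : ι → R} {x : R} {i : ι}
    (hi : g i * x = -(x * g i)) (hne : ∀ j, j ≠ i → Commute (g j) x) {l : List ι}
    (hl : l.Nodup) (hil : i ∈ l) : (l.map g).prod * x = -(x * (l.map g).prod) := by
  induction l with
  | nil => simp at hil
  | cons k l ih =>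
    rw [List.nodup_cons] at hl
    rw [List.map_cons, List.prod_cons]
    by_cases hk : k = i
    · subst hk
      have hc : Commute (l.map g).prod x := by
        refine Commute.list_prod_left _ _ fun y hy => ?_
        obtain ⟨j, hj, rfl⟩ := List.mem_map.1 hy
        exact hne j fun h => hl.1 (h ▸ hj)
      rw [mul_assoc, hc.eq, ← mul_assoc, hi, neg_mul, mul_assoc]
    · have hil' : i ∈ l := (List.mem_cons.1 hil).resolve_left fun h => hk h.symm
      rw [mul_assoc, ih hl.2 hil', mul_neg, ← mul_assoc, (hne k hk).eq, mul_assoc]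

theorem unitary_anticomm_star {R : Type*} [Ring R] [StarRing R] {u x : R} (hu : u ∈ unitary R)
    (h : u * x = -(x * u)) : x * star u + star u * x = 0 := by
  calc x * star u + star u * x = star u * u * x * star u + star u * x * (u * star u) := by
        simp [Unitary.star_mul_self_of_mem hu, Unitary.mul_star_self_of_mem hu]
    _ = star u * (u * x + x * u) * star u := by noncomm_ring
    _ = 0 := by simp [h]

theorem conjTranspose_raising : (!![0, 1; 0, 0] : Matrix (Fin 2) (Fin 2) ℂ)ᴴ = !![0, 0; 1, 0] := by
  ext i j
  fin_cases i <;> fin_cases j <;> simp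

open Matrix Kronecker

theorem car_extension {n N : ℕ} (a : Fin n → Matrix (Fin N) (Fin N) ℂ)
    (hCAR : ∀ i j : Fin n,
      a i * a j + a j * a i = 0 ∧
      a i * (a j)ᴴ + (a j)ᴴ * a i = (if i = j then 1 else 0))
    (Γ : Matrix (Fin N) (Fin N) ℂ)
    (hΓ : Γ = (List.ofFn (fun i : Fin n => 1 - 2 • ((a i)ᴴ * a i))).prod)
    (b : Fin (n + 1) → Matrix (Fin N × Fin 2) (Fin N × Fin 2) ℂ)
    (hb₁ : ∀ i : Fin n, b (Fin.castSucc i) = (a i) ⊗ₖ (1 : Matrix (Fin 2) (Fin 2) ℂ))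
    (hb₂ : b (Fin.last n) = Γ ⊗ₖ !![0, 1; 0, 0]) :
    ∀ i j : Fin (n + 1),
      b i * b j + b j * b i = 0 ∧
      b i * (b j)ᴴ + (b j)ᴴ * b i = (if i = j then 1 else 0) := by
  simp only [← star_eq_conjTranspose] at hCAR hΓ
  have hsq (i : Fin n) : a i * a i = 0 := by
    have h := (hCAR i i).1
    rw [← two_smul ℂ] at h
    exact (smul_eq_zero.1 h).resolve_left two_ne_zero
  have hself (i : Fin n) : a i * star (a i) + star (a i) * a i = 1 := by
    simpa using (hCAR i i).2
  have hU : Γ ∈ unitary (Matrix (Fin N) (Fin N) ℂ) := by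
    rw [hΓ]
    refine list_prod_mem fun y hy => ?_
    obtain ⟨i, rfl⟩ := (List.mem_ofFn' _ _).1 hy
    exact one_sub_two_star_mul_self_mem_unitary (hsq i) (hself i)
  have hanti (i : Fin n) : Γ * a i = -(a i * Γ) := by
    rw [hΓ, List.ofFn_eq_map]
    refine List.prod_map_mul_eq_neg_mul_prod_map (i := i)
      (one_sub_two_star_mul_self_anticomm (hsq i) (hself i)) (fun j hj => ?_)
      (List.nodup_finRange n) (List.mem_finRange i)
    exact one_sub_two_star_mul_self_comm (hCAR i j).1 (by simpa [hj.symm] using (hCAR i j).2)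
  have hstar (i : Fin n) : a i * Γᴴ + Γᴴ * a i = 0 := unitary_anticomm_star hU (hanti i)
  have hstar' (i : Fin n) : Γ * (a i)ᴴ + (a i)ᴴ * Γ = 0 := by
    simpa using congrArg conjTranspose (hstar i)
  have hΓ₁ : Γ * Γᴴ = 1 := Unitary.mul_star_self_of_mem hU
  have hΓ₂ : Γᴴ * Γ = 1 := Unitary.star_mul_self_of_mem hU
  simp only [star_eq_conjTranspose] at hCAR
  intro i j
  induction i using Fin.lastCases with
  | last =>
    induction j using Fin.lastCases with
    | last =>
      rw [hb₂, conjTranspose_kronecker, conjTranspose_raising]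
      simp only [← mul_kronecker_mul, hΓ₁, hΓ₂, ← kronecker_add, if_true]
      constructor
      · have h : (!![0, 1; 0, 0] * !![0, 1; 0, 0] : Matrix (Fin 2) (Fin 2) ℂ) = 0 := by
          ext i j
          fin_cases i <;> fin_cases j <;> simp
        simp only [h, kronecker_zero, add_zero]
      · rw [← one_kronecker_one]
        congr 1
        ext i j
        fin_cases i <;> fin_cases j <;> simp
    | cast j =>
      rw [hb₂, hb₁, conjTranspose_kronecker]
      simp only [← mul_kronecker_mul, conjTranspose_one, mul_one, one_mul, ← add_kronecker,
        hanti, hstar', neg_add_cancel, zero_kronecker, true_and]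
      rw [if_neg (Fin.castSucc_lt_last j).ne']
  | cast i =>
    induction j using Fin.lastCases with
    | last =>
      rw [hb₂, hb₁, conjTranspose_kronecker]
      simp only [← mul_kronecker_mul, mul_one, one_mul, ← add_kronecker,
        hanti, hstar, add_neg_cancel, zero_kronecker, true_and]
      rw [if_neg (Fin.castSucc_lt_last i).ne]
    | cast j =>
      rw [hb₁, hb₁, conjTranspose_kronecker]
      simp only [← mul_kronecker_mul, conjTranspose_one, mul_one, ← add_kronecker,
        hCAR, zero_kronecker, true_and, Fin.castSucc_inj]
      split_ifs <;> simp
end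

section
/- For every n : ℕ there exists a family a : Fin n → Matrix (Fin (2^n)) (Fin (2^n)) ℂ satisfying the CAR relations (with star given by conjugate transpose) such that the star-subalgebra of Matrix (Fin (2^n)) (Fin (2^n)) ℂ generated by the range of a is the whole matrix algebra: StarSubalgebra.adjoin ℂ (Set.range a) = ⊤. (In other words, CAR(ℂⁿ) is realized as, and generates, the full matrix algebra M_{2^n}(ℂ).) -/
open Matrix

/-- The canonical anticommutation relations for a family of elements of a star ring. -/
def SatisfiesCAR {ι A : Type*} [DecidableEq ι] [Ring A] [Star A] (a : ι → A) : Prop :=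
  ∀ i j, a i * a j + a j * a i = 0 ∧
    a i * star (a j) + star (a j) * a i = (if i = j then 1 else 0)

theorem SatisfiesCAR.map {ι A B F : Type*} [DecidableEq ι] [Ring A] [Star A] [Ring B] [Star B]
    [FunLike F A B] [RingHomClass F A B] [StarHomClass F A B] {a : ι → A}
    (h : SatisfiesCAR a) (f : F) : SatisfiesCAR (fun i => f (a i)) := by
  intro i j
  obtain ⟨h₁, h₂⟩ := h i j
  refine ⟨by simp only [← map_mul, ← map_add, h₁, map_zero], ?_⟩
  simp only [← map_star, ← map_mul, ← map_add, h₂]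
  split_ifs <;> simp

/-- Reindexing the rows and columns of square matrices, as a star algebra homomorphism. -/
def Matrix.reindexStarAlgHom {m n : Type*} [Fintype m] [Fintype n] [DecidableEq m] [DecidableEq n]
    (e : m ≃ n) : Matrix m m ℂ →⋆ₐ[ℂ] Matrix n n ℂ where
  __ := (Matrix.reindexAlgEquiv ℂ ℂ e).toAlgHom
  map_star' _ := rfl

theorem Matrix.reindexStarAlgHom_surjective {m n : Type*} [Fintype m] [Fintype n] [DecidableEq m]
    [DecidableEq n] (e : m ≃ n) : Function.Surjective (Matrix.reindexStarAlgHom e) :=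
  (Matrix.reindexAlgEquiv ℂ ℂ e).surjective

theorem StarAlgebra.adjoin_range_comp_eq_top {ι R A B : Type*} [CommSemiring R] [StarRing R]
    [Semiring A] [StarRing A] [Algebra R A] [StarModule R A]
    [Semiring B] [StarRing B] [Algebra R B] [StarModule R B] {a : ι → A}
    (h : StarAlgebra.adjoin R (Set.range a) = ⊤) (f : A →⋆ₐ[R] B) (hf : Function.Surjective f) :
    StarAlgebra.adjoin R (Set.range fun i => f (a i)) = ⊤ := by
  have := StarAlgHom.map_adjoin f (Set.range a)
  rw [h, ← Set.range_comp] at this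
  refine StarSubalgebra.eq_top_iff.mpr fun y => ?_
  obtain ⟨x, rfl⟩ := hf y
  change f x ∈ StarAlgebra.adjoin R (Set.range (f ∘ a))
  rw [← this]
  exact StarSubalgebra.mem_map.mpr ⟨x, StarSubalgebra.mem_top, rfl⟩

/-- The Jordan–Wigner step: adjoin one more annihilation operator, doubling the space. -/
def jordanWignerSucc {n : ℕ} {m : Type*} [DecidableEq m] (a : Fin n → Matrix m m ℂ) :
    Fin (n + 1) → Matrix (m ⊕ m) (m ⊕ m) ℂ :=
  Fin.cons (fromBlocks 0 1 0 0) fun i => fromBlocks (a i) 0 0 (-a i)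

theorem SatisfiesCAR.jordanWignerSucc {n : ℕ} {m : Type*} [Fintype m] [DecidableEq m]
    {a : Fin n → Matrix m m ℂ} (h : SatisfiesCAR a) : SatisfiesCAR (jordanWignerSucc a) := by
  intro i j
  refine Fin.cases ?_ (fun i => ?_) i <;> refine Fin.cases ?_ (fun j => ?_) j
  · simp [_root_.jordanWignerSucc, star_eq_conjTranspose, fromBlocks_conjTranspose,
      fromBlocks_multiply, fromBlocks_add]
  · simp [_root_.jordanWignerSucc, star_eq_conjTranspose, fromBlocks_conjTranspose,
      fromBlocks_multiply, fromBlocks_add, (Fin.succ_ne_zero _).symm]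
  · simp [_root_.jordanWignerSucc, star_eq_conjTranspose, fromBlocks_conjTranspose,
      fromBlocks_multiply, fromBlocks_add]
  · obtain ⟨h₁, h₂⟩ := h i j
    rw [star_eq_conjTranspose] at h₂
    simp only [_root_.jordanWignerSucc, star_eq_conjTranspose, fromBlocks_conjTranspose,
      fromBlocks_multiply, fromBlocks_add, Fin.cons_succ, Fin.succ_inj, conjTranspose_neg,
      neg_mul_neg, mul_zero, zero_mul, add_zero, zero_add, conjTranspose_zero, h₁, h₂]
    split_ifs <;> simp

theorem StarAlgebra.adjoin_range_jordanWignerSucc {n : ℕ} {m : Type*} [Fintype m] [DecidableEq m]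
    {a : Fin n → Matrix m m ℂ} (h : StarAlgebra.adjoin ℂ (Set.range a) = ⊤) :
    StarAlgebra.adjoin ℂ (Set.range (jordanWignerSucc a)) = ⊤ := by
  set S := StarAlgebra.adjoin ℂ (Set.range (jordanWignerSucc a))
  have hu : fromBlocks 0 1 0 0 ∈ S := StarAlgebra.subset_adjoin ℂ _ ⟨0, rfl⟩
  have hu' : fromBlocks 0 0 1 0 ∈ S := by
    simpa [star_eq_conjTranspose, fromBlocks_conjTranspose] using star_mem hu
  have he : fromBlocks 1 0 0 0 ∈ S := by
    simpa [fromBlocks_multiply] using mul_mem hu hu'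
  have key : ∀ x : Matrix m m ℂ, fromBlocks x 0 0 0 ∈ S := by
    intro x
    have hx : x ∈ StarAlgebra.adjoin ℂ (Set.range a) := h ▸ StarSubalgebra.mem_top
    induction hx using StarAlgebra.adjoin_induction with
    | mem x hx =>
      obtain ⟨i, rfl⟩ := hx
      have hi : fromBlocks (a i) 0 0 (-a i) ∈ S := StarAlgebra.subset_adjoin ℂ _ ⟨i.succ, rfl⟩
      simpa [fromBlocks_multiply] using mul_mem he hi
    | algebraMap r =>
      simpa [fromBlocks_smul, Algebra.algebraMap_eq_smul_one] using S.smul_mem he r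
    | add x y _ _ hx hy => simpa [fromBlocks_add] using add_mem hx hy
    | mul x y _ _ hx hy => simpa [fromBlocks_multiply] using mul_mem hx hy
    | star x _ hx =>
      simpa [star_eq_conjTranspose, fromBlocks_conjTranspose] using star_mem hx
  refine StarSubalgebra.eq_top_iff.mpr fun x => ?_
  rw [← fromBlocks_toBlocks x]
  have := add_mem (add_mem (key x.toBlocks₁₁) (mul_mem (key x.toBlocks₁₂) hu))
    (add_mem (mul_mem hu' (key x.toBlocks₂₁)) (mul_mem (mul_mem hu' (key x.toBlocks₂₂)) hu))
  simpa [fromBlocks_multiply, fromBlocks_add] using this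

theorem car_realization (n : ℕ) :
    ∃ a : Fin n → Matrix (Fin (2 ^ n)) (Fin (2 ^ n)) ℂ,
      (∀ i j : Fin n,
        a i * a j + a j * a i = 0 ∧
        a i * (a j)ᴴ + (a j)ᴴ * a i = (if i = j then 1 else 0)) ∧
      StarAlgebra.adjoin ℂ (Set.range a) = ⊤ := by
  induction n with
  | zero =>
    refine ⟨Fin.elim0, fun i => i.elim0, StarSubalgebra.eq_top_iff.mpr fun x => ?_⟩
    have hx : x = algebraMap ℂ _ (x 0 0) := by
      ext i j
      obtain rfl : i = 0 := Subsingleton.elim (α := Fin 1) _ _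
      obtain rfl : j = 0 := Subsingleton.elim (α := Fin 1) _ _
      simp [algebraMap_matrix_apply]
    rw [hx]
    exact StarSubalgebra.algebraMap_mem _ _
  | succ n ih =>
    obtain ⟨a, hcar, htop⟩ := ih
    let f := Matrix.reindexStarAlgHom
      (finSumFinEquiv.trans (finCongr (by ring)) : Fin (2 ^ n) ⊕ Fin (2 ^ n) ≃ Fin (2 ^ (n + 1)))
    exact ⟨fun i => f (jordanWignerSucc a i),
      (SatisfiesCAR.jordanWignerSucc (a := a) hcar).map f,
      StarAlgebra.adjoin_range_comp_eq_top (StarAlgebra.adjoin_range_jordanWignerSucc htop) f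
        (Matrix.reindexStarAlgHom_surjective _)⟩
end

section
/- Let A be a nontrivial unital ℂ-algebra with a star-ring structure that is a star module over ℂ, and let a : Fin n → A satisfy the CAR relations. Then there exists an injective unital star-algebra homomorphism φ : Matrix (Fin (2^n)) (Fin (2^n)) ℂ →⋆ₐ[ℂ] A whose range is exactly the star-subalgebra of A generated by the elements a i, i.e. φ.range = StarSubalgebra.adjoin ℂ (Set.range a). (This expresses that the algebra generated by a CAR family of size n is uniquely determined up to *-isomorphism, namely isomorphic to M_{2^n}(ℂ).) -/
theorem starAlgebra_adjoin_union {A : Type*} [Ring A] [Algebra ℂ A] [StarRing A] [StarModule ℂ A]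
    (s t : Set A) :
    StarAlgebra.adjoin ℂ (s ∪ t) = StarAlgebra.adjoin ℂ s ⊔ StarAlgebra.adjoin ℂ t :=
  StarAlgebra.gc.l_sup

/-- A self-adjoint system of matrix units in a star ring, indexed by `ι`. -/
structure IsStarMatrixUnits {ι A : Type*} [Fintype ι] [DecidableEq ι] [Ring A] [StarRing A]
    (e : ι → ι → A) : Prop where
  mul_eq : ∀ i j k l, e i j * e k l = if j = k then e i l else 0
  sum_diag : ∑ i, e i i = 1
  star_eq : ∀ i j, star (e i j) = e j i

namespace IsStarMatrixUnits

variable {ι κ A : Type*} [Fintype ι] [DecidableEq ι] [Fintype κ] [DecidableEq κ]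
  [Ring A] [StarRing A]

section Hom

variable [Algebra ℂ A] [StarModule ℂ A]

/-- The star-algebra homomorphism from the full matrix algebra determined by matrix units. -/
def hom {e : ι → ι → A} (he : IsStarMatrixUnits e) : Matrix ι ι ℂ →⋆ₐ[ℂ] A :=
  { AlgHom.ofLinearMap
      ({ toFun := fun M => ∑ i, ∑ j, M i j • e i j
         map_add' := fun M N => by simp [add_smul, Finset.sum_add_distrib]
         map_smul' := fun c M => by simp [mul_smul, Finset.smul_sum] } : Matrix ι ι ℂ →ₗ[ℂ] A)
      (by simp [Matrix.one_apply, ite_smul, he.sum_diag])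
      (fun M N => by
        simp only [LinearMap.coe_mk, AddHom.coe_mk, Finset.sum_mul, Finset.mul_sum,
          smul_mul_smul_comm, he.mul_eq, Matrix.mul_apply, Finset.sum_smul, smul_ite, smul_zero,
          Finset.sum_ite_eq', Finset.mem_univ, if_true]
        rw [Finset.sum_congr rfl fun i _ => Finset.sum_comm, Finset.sum_comm]
        exact Finset.sum_congr rfl fun k _ => Finset.sum_comm) with
    map_star' := fun M => by
      change ∑ i, ∑ j, (star M) i j • e i j = star (∑ i, ∑ j, M i j • e i j)
      simp only [star_sum, star_smul, he.star_eq, Matrix.star_apply]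
      exact Finset.sum_comm }

theorem hom_apply {e : ι → ι → A} (he : IsStarMatrixUnits e) (M : Matrix ι ι ℂ) :
    he.hom M = ∑ i, ∑ j, M i j • e i j := rfl

theorem hom_single {e : ι → ι → A} (he : IsStarMatrixUnits e) (i j : ι) :
    he.hom (Matrix.single i j 1) = e i j := by
  simp [hom_apply, Matrix.single_apply, ite_and, ite_smul]

theorem hom_range {e : ι → ι → A} (he : IsStarMatrixUnits e) :
    he.hom.range = StarAlgebra.adjoin ℂ (Set.range (Function.uncurry e)) := by
  apply le_antisymm
  · rintro _ ⟨M, rfl⟩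
    change he.hom M ∈ _
    rw [hom_apply]
    exact sum_mem fun i _ => sum_mem fun j _ =>
      SMulMemClass.smul_mem _ (StarAlgebra.subset_adjoin ℂ _ ⟨(i, j), rfl⟩)
  · refine StarAlgebra.adjoin_le ?_
    rintro _ ⟨⟨i, j⟩, rfl⟩
    exact ⟨Matrix.single i j 1, he.hom_single i j⟩

theorem hom_injective [Nonempty ι] [Nontrivial A] {e : ι → ι → A} (he : IsStarMatrixUnits e) :
    Function.Injective he.hom :=
  RingHom.injective (he.hom : Matrix ι ι ℂ →+* A)

end Hom

theorem reindex {e : ι → ι → A} (he : IsStarMatrixUnits e) (σ : κ ≃ ι) :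
    IsStarMatrixUnits fun i j => e (σ i) (σ j) where
  mul_eq i j k l := by simp [he.mul_eq]
  sum_diag := (Equiv.sum_comp σ fun i => e i i).trans he.sum_diag
  star_eq i j := he.star_eq _ _

theorem mul {f : κ → κ → A} {e : ι → ι → A} (hf : IsStarMatrixUnits f)
    (he : IsStarMatrixUnits e) (hfe : ∀ i j k l, Commute (f i j) (e k l)) :
    IsStarMatrixUnits fun p q : κ × ι => f p.1 q.1 * e p.2 q.2 where
  mul_eq p q r s := by
    rw [(hfe r.1 s.1 p.2 q.2).symm.mul_mul_mul_comm, hf.mul_eq, he.mul_eq]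
    by_cases h1 : q.1 = r.1 <;> by_cases h2 : q.2 = r.2 <;> simp [Prod.ext_iff, h1, h2]
  sum_diag := by
    simp only [Fintype.sum_prod_type, ← Finset.mul_sum, he.sum_diag, mul_one, hf.sum_diag]
  star_eq p q := by
    rw [star_mul, he.star_eq, hf.star_eq, (hfe _ _ _ _).eq]

variable [Algebra ℂ A] [StarModule ℂ A]

theorem adjoin_mul {f : κ → κ → A} {e : ι → ι → A} (hf : IsStarMatrixUnits f)
    (he : IsStarMatrixUnits e) :
    StarAlgebra.adjoin ℂ (Set.range fun p : (κ × ι) × (κ × ι) => f p.1.1 p.2.1 * e p.1.2 p.2.2) =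
      StarAlgebra.adjoin ℂ (Set.range (Function.uncurry f) ∪ Set.range (Function.uncurry e)) := by
  apply le_antisymm <;> refine StarAlgebra.adjoin_le ?_
  · rintro _ ⟨p, rfl⟩
    exact mul_mem (StarAlgebra.subset_adjoin ℂ _ (.inl ⟨(p.1.1, p.2.1), rfl⟩))
      (StarAlgebra.subset_adjoin ℂ _ (.inr ⟨(p.1.2, p.2.2), rfl⟩))
  · rintro _ (⟨⟨i, j⟩, rfl⟩ | ⟨⟨i, j⟩, rfl⟩)
    · rw [SetLike.mem_coe, Function.uncurry_apply_pair, ← mul_one (f i j), ← he.sum_diag,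
        Finset.mul_sum]
      exact sum_mem fun k _ => StarAlgebra.subset_adjoin ℂ _ ⟨((i, k), (j, k)), rfl⟩
    · rw [SetLike.mem_coe, Function.uncurry_apply_pair, ← one_mul (e i j), ← hf.sum_diag,
        Finset.sum_mul]
      exact sum_mem fun k _ => StarAlgebra.subset_adjoin ℂ _ ⟨((k, i), (k, j)), rfl⟩

end IsStarMatrixUnits

section CAR

variable {A : Type*} [Ring A] [StarRing A]

/-- The `2 × 2` matrix units generated by a single fermionic mode. -/
def fermionUnits (c : A) : Fin 2 → Fin 2 → A :=
  ![![c * star c, c], ![star c, star c * c]]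

theorem mul_star_mul_self_of_fermion {c : A} (hsq : c * c = 0)
    (hc : c * star c + star c * c = 1) : c * star c * c = c := by
  have := congrArg (c * ·) hc
  simpa [mul_add, ← mul_assoc, hsq] using this

theorem isStarMatrixUnits_fermionUnits {c : A} (hsq : c * c = 0)
    (hc : c * star c + star c * c = 1) : IsStarMatrixUnits (fermionUnits c) where
  mul_eq := by
    have h1 := mul_star_mul_self_of_fermion hsq hc
    have h2 : star c * star c = 0 := by rw [← star_mul, hsq, star_zero]
    have h3 : star c * c * star c = star c := by simpa [mul_assoc] using congrArg star h1
    have h4 (x : A) : c * (c * x) = 0 := by rw [← mul_assoc, hsq, zero_mul]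
    have h5 (x : A) : star c * (star c * x) = 0 := by rw [← mul_assoc, h2, zero_mul]
    rw [mul_assoc] at h1 h3
    simp [fermionUnits, Fin.forall_fin_two, mul_assoc, hsq, h1, h2, h3, h4, h5]
  sum_diag := by simpa [fermionUnits] using hc
  star_eq := by simp [fermionUnits, Fin.forall_fin_two]

/-- The parity operator of a single fermionic mode. -/
def fermionParity (c : A) : A := c * star c - star c * c

theorem star_fermionParity (c : A) : star (fermionParity c) = fermionParity c := by
  simp [fermionParity]

theorem fermionParity_mul_self {c : A} (hsq : c * c = 0)
    (hc : c * star c + star c * c = 1) : fermionParity c * fermionParity c = 1 := by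
  have hf := (isStarMatrixUnits_fermionUnits hsq hc).mul_eq
  have h00 := hf 0 0 0 0
  have h01 := hf 0 0 1 1
  have h10 := hf 1 1 0 0
  have h11 := hf 1 1 1 1
  simp only [fermionUnits, Matrix.cons_val_zero, Matrix.cons_val_one, zero_ne_one, one_ne_zero,
    if_true, if_false] at h00 h01 h10 h11
  rw [fermionParity, mul_sub, sub_mul, sub_mul, h00, h01, h10, h11, ← hc]
  abel

theorem fermionParity_mul {c : A} (hsq : c * c = 0) (hc : c * star c + star c * c = 1) :
    fermionParity c * c = c := by
  rw [fermionParity, sub_mul, mul_star_mul_self_of_fermion hsq hc, mul_assoc, hsq, mul_zero,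
    sub_zero]

theorem mul_fermionParity {c : A} (hsq : c * c = 0) (hc : c * star c + star c * c = 1) :
    c * fermionParity c = -c := by
  rw [fermionParity, mul_sub, ← mul_assoc, hsq, ← mul_assoc,
    mul_star_mul_self_of_fermion hsq hc, zero_mul, zero_sub]

theorem commute_fermionParity {c x : A} (h1 : c * x + x * c = 0)
    (h2 : x * star c + star c * x = 0) : Commute (fermionParity c) x := by
  have h1' : x * c = -(c * x) := eq_neg_of_add_eq_zero_right h1
  have h2' : x * star c = -(star c * x) := eq_neg_of_add_eq_zero_left h2
  rw [commute_iff_eq, fermionParity, mul_sub, sub_mul, ← mul_assoc, ← mul_assoc, h1', h2', neg_mul,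
    neg_mul, mul_assoc c x, mul_assoc _ x c, h1', h2', mul_neg, mul_neg, neg_neg, neg_neg,
    mul_assoc, mul_assoc]

theorem commute_fermionParity_mul {c x : A} (hsq : c * c = 0)
    (hc : c * star c + star c * c = 1) (h : c * x + x * c = 0) :
    Commute c (fermionParity c * x) := by
  rw [commute_iff_eq, ← mul_assoc, mul_fermionParity hsq hc, mul_assoc,
    eq_neg_of_add_eq_zero_right h, mul_neg, ← mul_assoc, fermionParity_mul hsq hc, neg_mul]

theorem commute_star_fermionParity_mul {c x : A} (hsq : c * c = 0)
    (hc : c * star c + star c * c = 1) (h : x * star c + star c * x = 0) :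
    Commute (star c) (fermionParity c * x) := by
  have h1 : star c * fermionParity c = star c := by
    simpa [star_fermionParity] using congrArg star (fermionParity_mul hsq hc)
  have h2 : fermionParity c * star c = -star c := by
    simpa [star_fermionParity] using congrArg star (mul_fermionParity hsq hc)
  rw [commute_iff_eq, ← mul_assoc, h1, mul_assoc, eq_neg_of_add_eq_zero_left h, mul_neg,
    ← mul_assoc, h2, neg_mul, neg_neg]

/-- The canonical anticommutation relations. -/
def IsCAR {n : ℕ} (a : Fin n → A) : Prop :=
  ∀ i j : Fin n, a i * a j + a j * a i = 0 ∧
    a i * star (a j) + star (a j) * a i = (if i = j then 1 else 0)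

namespace IsCAR

theorem star_mul_add {n : ℕ} {a : Fin n → A} (ha : IsCAR a) {i j : Fin n} (h : i ≠ j) :
    a i * star (a j) + star (a j) * a i = 0 := by
  simpa [h] using (ha i j).2

theorem mul_star_self_add {n : ℕ} {a : Fin n → A} (ha : IsCAR a) (i : Fin n) :
    a i * star (a i) + star (a i) * a i = 1 := by
  simpa using (ha i i).2

theorem mul_self [Algebra ℂ A] {n : ℕ} {a : Fin n → A} (ha : IsCAR a) (i : Fin n) :
    a i * a i = 0 := by
  have h := (ha i i).1
  rw [← two_smul ℂ] at h
  exact (smul_eq_zero.mp h).resolve_left two_ne_zero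

/-- Twisting the remaining modes by the parity of the first one preserves the relations. -/
theorem twist [Algebra ℂ A] {n : ℕ} {a : Fin (n + 1) → A} (ha : IsCAR a) :
    IsCAR fun i : Fin n => fermionParity (a 0) * a i.succ := by
  set u := fermionParity (a 0) with hu
  have huu : u * u = 1 := fermionParity_mul_self (ha.mul_self 0) (ha.mul_star_self_add 0)
  have hcomm (i : Fin n) : Commute u (a i.succ) :=
    commute_fermionParity (ha _ _).1 (ha.star_mul_add (Fin.succ_ne_zero i))
  have hstar : star u = u := star_fermionParity _
  have hcomm' (i : Fin n) : Commute u (star (a i.succ)) := by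
    simpa [hstar] using (hcomm i).star_star
  have key {x y : A} (hx : Commute u x) : (u * x) * (u * y) = x * y := by
    rw [hx.eq, mul_assoc, ← mul_assoc u, huu, one_mul]
  intro i j
  have hs : star (u * a j.succ) = u * star (a j.succ) := by
    rw [star_mul, hstar, (hcomm' j).eq]
  refine ⟨?_, ?_⟩
  · rw [key (hcomm i), key (hcomm j)]
    exact (ha _ _).1
  · simpa [hs, key (hcomm i), key (hcomm' j)] using (ha i.succ j.succ).2

theorem adjoin_twist [Algebra ℂ A] [StarModule ℂ A] {n : ℕ} {a : Fin (n + 1) → A}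
    (ha : IsCAR a) :
    StarAlgebra.adjoin ℂ (Set.range (Function.uncurry (fermionUnits (a 0))) ∪
      Set.range fun i : Fin n => fermionParity (a 0) * a i.succ) =
        StarAlgebra.adjoin ℂ (Set.range a) := by
  have hpar {S : StarSubalgebra ℂ A} (h : a 0 ∈ S) : fermionParity (a 0) ∈ S :=
    sub_mem (mul_mem h (star_mem h)) (mul_mem (star_mem h) h)
  apply le_antisymm <;> refine StarAlgebra.adjoin_le ?_
  · have hmem (i) : a i ∈ StarAlgebra.adjoin ℂ (Set.range a) :=
      StarAlgebra.subset_adjoin ℂ _ ⟨i, rfl⟩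
    rintro _ (⟨⟨i, j⟩, rfl⟩ | ⟨i, rfl⟩)
    · have h := hmem 0
      revert i j
      simp only [Fin.forall_fin_two]
      exact ⟨⟨mul_mem h (star_mem h), h⟩, star_mem h, mul_mem (star_mem h) h⟩
    · exact mul_mem (hpar (hmem 0)) (hmem _)
  · have h0 : a 0 ∈ StarAlgebra.adjoin ℂ (Set.range (Function.uncurry (fermionUnits (a 0))) ∪
        Set.range fun i : Fin n => fermionParity (a 0) * a i.succ) :=
      StarAlgebra.subset_adjoin ℂ _ (.inl ⟨(0, 1), rfl⟩)
    rintro _ ⟨i, rfl⟩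
    refine Fin.cases h0 (fun i => ?_) i
    rw [SetLike.mem_coe, ← one_mul (a i.succ),
      ← fermionParity_mul_self (ha.mul_self 0) (ha.mul_star_self_add 0), mul_assoc]
    exact mul_mem (hpar h0) (StarAlgebra.subset_adjoin ℂ _ (.inr ⟨i, rfl⟩))

theorem exists_isStarMatrixUnits [Algebra ℂ A] [StarModule ℂ A] {n : ℕ} {a : Fin n → A}
    (ha : IsCAR a) : ∃ e : Fin (2 ^ n) → Fin (2 ^ n) → A, IsStarMatrixUnits e ∧
      StarAlgebra.adjoin ℂ (Set.range (Function.uncurry e)) =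
        StarAlgebra.adjoin ℂ (Set.range a) := by
  induction n with
  | zero =>
    refine ⟨fun _ _ => 1, ⟨fun i j k l => ?_, by simp, by simp⟩, ?_⟩
    · simp [Subsingleton.elim (α := Fin 1) j k]
    · apply le_antisymm <;> refine StarAlgebra.adjoin_le ?_
      · rintro _ ⟨_, rfl⟩
        exact one_mem _
      · rintro _ ⟨i, rfl⟩
        exact i.elim0
  | succ n ih =>
    obtain ⟨e, he, hadj⟩ := ih ha.twist
    have hsq := ha.mul_self 0
    have hc := ha.mul_star_self_add 0
    have hf := isStarMatrixUnits_fermionUnits hsq hc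
    have hle : StarAlgebra.adjoin ℂ (Set.range (Function.uncurry e)) ≤
        StarSubalgebra.centralizer ℂ {a 0} := by
      rw [hadj]
      refine StarAlgebra.adjoin_le ?_
      rintro _ ⟨i, rfl⟩
      have h1 := commute_fermionParity_mul hsq hc (ha 0 i.succ).1
      have h2 := commute_star_fermionParity_mul hsq hc (ha.star_mul_add (Fin.succ_ne_zero i))
      rw [SetLike.mem_coe, StarSubalgebra.mem_centralizer_iff]
      rintro _ rfl
      exact ⟨h1.eq, h2.eq⟩
    have hfe (i j k l) : Commute (fermionUnits (a 0) i j) (e k l) := by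
      have hmem := hle (StarAlgebra.subset_adjoin ℂ _ ⟨(k, l), rfl⟩)
      rw [StarSubalgebra.mem_centralizer_iff] at hmem
      obtain ⟨h1, h2⟩ := hmem _ rfl
      change Commute _ (e k l) at h1
      change Commute _ (e k l) at h2
      revert i j
      simp only [Fin.forall_fin_two]
      exact ⟨⟨h1.mul_left h2, h1⟩, h2, h2.mul_left h1⟩
    let σ : Fin (2 ^ (n + 1)) ≃ Fin 2 × Fin (2 ^ n) :=
      (finCongr (pow_succ' 2 n)).trans finProdFinEquiv.symm
    refine ⟨_, (hf.mul he hfe).reindex σ, ?_⟩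
    rw [← ha.adjoin_twist, starAlgebra_adjoin_union, ← hadj, ← starAlgebra_adjoin_union,
      ← hf.adjoin_mul he, ← (σ.prodCongr σ).surjective.range_comp]
    rfl

end IsCAR

end CAR

theorem car_uniqueness {A : Type*} [Ring A] [Algebra ℂ A] [StarRing A] [StarModule ℂ A]
    [Nontrivial A] {n : ℕ} (a : Fin n → A)
    (hCAR : ∀ i j : Fin n,
      a i * a j + a j * a i = 0 ∧
      a i * star (a j) + star (a j) * a i = (if i = j then 1 else 0)) :
    ∃ φ : Matrix (Fin (2 ^ n)) (Fin (2 ^ n)) ℂ →⋆ₐ[ℂ] A,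
      Function.Injective φ ∧ φ.range = StarAlgebra.adjoin ℂ (Set.range a) := by
  obtain ⟨e, he, hadj⟩ := IsCAR.exists_isStarMatrixUnits hCAR
  exact ⟨he.hom, he.hom_injective, he.hom_range.trans hadj⟩
end

section
/- For every m : ℕ with 1 ≤ m, the set D of unit vectors q in EuclideanSpace ℝ (Fin m) with all coordinates nonnegative and all squared coordinates rational (i.e. ∀ i, 0 ≤ q i, ∑ i, (q i)^2 = 1, and ∀ i, ∃ r : ℚ, (q i)^2 = (r : ℝ)) is dense in the set S of all unit vectors with nonnegative coordinates: S ⊆ closure D. -/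
open Filter Topology in
/-- Normalized roundings `⌈a i * x⌉₊ / ∑ j, ⌈a j * x⌉₊` of a probability vector converge to it. -/
lemma tendsto_natCeil_mul_div_sum {ι : Type*} [Fintype ι] {a : ι → ℝ} (ha : ∀ i, 0 ≤ a i)
    (hsum : ∑ i, a i = 1) (i : ι) :
    Tendsto (fun x : ℝ => (⌈a i * x⌉₊ : ℝ) / ∑ j, (⌈a j * x⌉₊ : ℝ)) atTop (𝓝 (a i)) := by
  have hc (j : ι) : Tendsto (fun x : ℝ => (⌈a j * x⌉₊ : ℝ) / x) atTop (𝓝 (a j)) :=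
    tendsto_nat_ceil_mul_div_atTop (ha j)
  have h := (hc i).div (tendsto_finsetSum Finset.univ fun j _ => hc j) (by simp [hsum])
  rw [hsum, div_one] at h
  refine h.congr' ?_
  filter_upwards [eventually_ne_atTop 0] with x hx
  simp only [Pi.div_apply, ← Finset.sum_div]
  exact div_div_div_cancel_right₀ hx _ _

theorem rational_schmidt_dense (m : ℕ) (hm : 1 ≤ m) :
    {l : EuclideanSpace ℝ (Fin m) | (∀ i, 0 ≤ l i) ∧ ∑ i, (l i) ^ 2 = 1} ⊆
      closure {q : EuclideanSpace ℝ (Fin m) |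
        (∀ i, 0 ≤ q i) ∧ (∑ i, (q i) ^ 2 = 1) ∧ ∀ i, ∃ r : ℚ, (q i) ^ 2 = (r : ℝ)} := by
  rintro l ⟨hl, hsum⟩
  let w (x : ℝ) (i : Fin m) : ℝ := (⌈l i ^ 2 * x⌉₊ : ℝ) / ∑ j, (⌈l j ^ 2 * x⌉₊ : ℝ)
  have hw (x : ℝ) (i : Fin m) : √(w x i) ^ 2 = w x i := Real.sq_sqrt (by positivity)
  have hlim : Filter.Tendsto (fun x => WithLp.toLp 2 fun i => √(w x i)) Filter.atTop (nhds l) := by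
    refine ((PiLp.continuous_toLp 2 fun _ : Fin m => ℝ).tendsto l.ofLp).comp
      (tendsto_pi_nhds.2 fun i => ?_)
    have h := (tendsto_natCeil_mul_div_sum (fun j => sq_nonneg (l j)) hsum i).sqrt
    rwa [Real.sqrt_sq (hl i)] at h
  refine mem_closure_of_tendsto hlim ?_
  filter_upwards [Filter.eventually_gt_atTop 0] with x hx
  refine ⟨fun i => Real.sqrt_nonneg _, ?_, fun i => ?_⟩
  · have hpos : 0 < ∑ j, (⌈l j ^ 2 * x⌉₊ : ℝ) := by
      refine hx.trans_le ?_
      calc x = ∑ j, l j ^ 2 * x := by rw [← Finset.sum_mul, hsum, one_mul]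
        _ ≤ _ := Finset.sum_le_sum fun j _ => Nat.le_ceil _
    simp only [hw]
    simp only [w, ← Finset.sum_div]
    exact div_self hpos.ne'
  · exact ⟨(⌈l i ^ 2 * x⌉₊ : ℚ) / ∑ j, (⌈l j ^ 2 * x⌉₊ : ℚ), by simp only [hw]; simp [w]⟩
end
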